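/- As functions on the unit sphere S^{D−1}: (i) for every l ≥ 0, t^h·T_l^{i_1…i_l} = T_{l+1}^{h i_1…i_l} + (l/(D+2l−2))·𝒫^l{}^{i_1 i_2…i_l}_{h j_2…j_l} T_{l−1}^{j_2…j_l} (sum over j_2,…,j_l); (ii) for every l ≥ 1 with (D,l) ≠ (2,1), Σ_{i=1}^D t^i·T_l^{i i_2…i_l} = (1/(D+2l−2))·[D + l − 1 − (2l−2)/(D+2l−4)]·T_{l−1}^{i_2…i_l}; (iii) L² T_l^{i_1…i_l} = l(l+D−2)·T_l^{i_1…i_l}, where L² is the spherical Laplacian (the restriction to S^{D−1} of −Σ_{i<j}(x^i∂_j − x^j∂_i)²); (iv) Σ_{h=1}^D T_l^{i_1…i_{n−1} h h i_{n+2}…i_l} = 0 for each n = 1,…,l−1. -/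

import Mathlib

open scoped BigOperators

noncomputable section
namespace Fuzzy

/-- Matrices acting on `ℂ^D ⊗ ℂ^D`, indexed by pairs. -/
abbrev PairMat (D : ℕ) := Matrix (Fin D × Fin D) (Fin D × Fin D) ℂ

/-- The flip (permutation) operator `𝖯` on `ℂ^D ⊗ ℂ^D`: `𝖯^{hi}_{jk} = δ^h_k δ^i_j`. -/
def flipMat (D : ℕ) : PairMat D := fun p q => if p.1 = q.2 ∧ p.2 = q.1 then 1 else 0

/-- The trace projector `𝒫ᵗ`: `𝒫ᵗ{}^{hi}_{jk} = δ^{hi} δ_{jk} / D`. -/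
def traceMat (D : ℕ) : PairMat D :=
  fun p q => (if p.1 = p.2 then 1 else 0) * (if q.1 = q.2 then 1 else 0) / (D : ℂ)

/-- The symmetric projector `𝒫⁺ = (1 + 𝖯)/2`. -/
def symPlusMat (D : ℕ) : PairMat D := (2 : ℂ)⁻¹ • ((1 : PairMat D) + flipMat D)

/-- The antisymmetric projector `𝒫⁻ = (1 − 𝖯)/2`. -/
def symMinusMat (D : ℕ) : PairMat D := (2 : ℂ)⁻¹ • ((1 : PairMat D) - flipMat D)

/-- The trace-free symmetric projector `𝒫 = 𝒫⁺ − 𝒫ᵗ`. -/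
def PsMat (D : ℕ) : PairMat D := symPlusMat D - traceMat D

/-- `𝒫′ = 𝒫⁻ + 𝒫ᵗ`. -/
def PprimeMat (D : ℕ) : PairMat D := symMinusMat D + traceMat D

/-- Embedding of an operator on `ℂ^D ⊗ ℂ^D` acting on the tensor factors `n, n+1`
(0-based) of `(ℂ^D)^{⊗ l}`, and as the identity on the other factors. -/
def embAt (D l n : ℕ) (A : PairMat D) :
    Matrix (Fin l → Fin D) (Fin l → Fin D) ℂ := fun i j =>
  if h : n + 1 < l then
    A (i ⟨n, Nat.lt_of_succ_lt h⟩, i ⟨n + 1, h⟩) (j ⟨n, Nat.lt_of_succ_lt h⟩, j ⟨n + 1, h⟩) *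
      ∏ m : Fin l, (if m.val = n ∨ m.val = n + 1 then 1 else if i m = j m then 1 else 0)
  else 0

/-- Extension of an operator on `(ℂ^D)^{⊗ l}` to `(ℂ^D)^{⊗ (l+1)}`, acting as the
identity on the last tensor factor. -/
def extendLast (D l : ℕ) (A : Matrix (Fin l → Fin D) (Fin l → Fin D) ℂ) :
    Matrix (Fin (l + 1) → Fin D) (Fin (l + 1) → Fin D) ℂ := fun i j =>
  A (fun m => i m.castSucc) (fun m => j m.castSucc) *
    (if i (Fin.last l) = j (Fin.last l) then 1 else 0)

/-- Extension of an operator on `(ℂ^D)^{⊗ l}` to `(ℂ^D)^{⊗ (l+1)}`, acting as the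
identity on the first tensor factor. -/
def extendFirst (D l : ℕ) (A : Matrix (Fin l → Fin D) (Fin l → Fin D) ℂ) :
    Matrix (Fin (l + 1) → Fin D) (Fin (l + 1) → Fin D) ℂ := fun i j =>
  A (fun m => i m.succ) (fun m => j m.succ) * (if i 0 = j 0 then 1 else 0)

/-- The matrix `M(l+1) = (1/(l+1)) [1 + l·𝖯 − (2Dl/(D+2l−2))·𝒫ᵗ]`. -/
def MStep (D l : ℕ) : PairMat D :=
  ((l : ℂ) + 1)⁻¹ •
    ((1 : PairMat D) + (l : ℂ) • flipMat D -
      (2 * (D : ℂ) * (l : ℂ) / ((D : ℂ) + 2 * (l : ℂ) - 2)) • traceMat D)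

/-- The completely symmetric trace-free projector `𝒫^l` on `(ℂ^D)^{⊗ l}`, defined
recursively by `𝒫^1 = id`, `𝒫^{l+1} = 𝒫^l_{1…l} M(l+1)_{l(l+1)} 𝒫^l_{1…l}`. -/
def symProj (D : ℕ) : (l : ℕ) → Matrix (Fin l → Fin D) (Fin l → Fin D) ℂ
  | 0 => 1
  | 1 => 1
  | (l + 2) =>
      extendLast D (l + 1) (symProj D (l + 1)) * embAt D (l + 2) l (MStep D (l + 1)) *
        extendLast D (l + 1) (symProj D (l + 1))


open MvPolynomial

/-- Complex polynomials in `E` variables. -/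
abbrev Poly (E : ℕ) := MvPolynomial (Fin E) ℂ

/-- The Laplacian `Δ = Σ_i ∂_i ∂_i`. -/
def lap {E : ℕ} (φ : Poly E) : Poly E := ∑ i : Fin E, pderiv i (pderiv i φ)

/-- The angular momentum operator `L_{ij} = i (x^j ∂_i − x^i ∂_j)`. -/
def ang {E : ℕ} (i j : Fin E) (φ : Poly E) : Poly E :=
  Complex.I • (X j * pderiv i φ - X i * pderiv j φ)

/-- The square angular momentum `L² = (1/2) Σ_{i,j} L_{ij} L_{ij}`. -/
def lsq {E : ℕ} (φ : Poly E) : Poly E :=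
  (2 : ℂ)⁻¹ • ∑ i : Fin E, ∑ j : Fin E, ang i j (ang i j φ)

/-- The Euler (dilatation) operator `η = Σ_i x^i ∂_i`. -/
def eta {E : ℕ} (φ : Poly E) : Poly E := ∑ i : Fin E, X i * pderiv i φ

/-- `r² = Σ_i (x^i)²`. -/
def r2 (E : ℕ) : Poly E := ∑ i : Fin E, X i * X i

/-- The harmonic polynomials `X_l^{i_1…i_l} := 𝒫^l{}^{i_1…i_l}_{j_1…j_l} x^{j_1} ⋯ x^{j_l}`. -/
def harmX (E l : ℕ) (i : Fin l → Fin E) : Poly E :=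
  ∑ j : Fin l → Fin E, symProj E l i j • ∏ m : Fin l, X (j m)


/-- The unit sphere `S^{D−1} ⊂ ℝ^D`. -/
abbrev Sph (D : ℕ) := Metric.sphere (0 : EuclideanSpace ℝ (Fin D)) 1

/-- Complexified coordinates of a point of the sphere. -/
def crd {D : ℕ} (p : Sph D) : Fin D → ℂ := fun i => ((p : EuclideanSpace ℝ (Fin D)) i : ℂ)

/-- Restriction of a polynomial to the unit sphere. -/
def rest {D : ℕ} (φ : Poly D) : Sph D → ℂ := fun p => eval (crd p) φ

/-- The coordinate functions `t^i` on the sphere. -/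
def tfun {D : ℕ} (i : Fin D) : Sph D → ℂ := fun p => crd p i

/-- `T_l^{i_1…i_l}`: the restriction of the harmonic polynomial `X_l^{i_1…i_l}`
to the unit sphere. -/
def harmT (D l : ℕ) (i : Fin l → Fin D) : Sph D → ℂ := fun p => rest (harmX D l i) p

/-- The rotation-invariant surface measure `dα` on the unit sphere. -/
def sphMeasure (D : ℕ) : MeasureTheory.Measure (Sph D) :=
  (MeasureTheory.volume : MeasureTheory.Measure (EuclideanSpace ℝ (Fin D))).toSphere

/-- `mis(S^{D−1})`, the total measure of the unit sphere. -/
def mis (D : ℕ) : ℝ := (sphMeasure D Set.univ).toReal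

end Fuzzy

namespace Fuzzy

section Aux

open MvPolynomial

variable {D : ℕ}

/-- The Laplacian as a linear map. -/
def lapL (D : ℕ) : Poly D →ₗ[ℂ] Poly D :=
  ∑ i : Fin D, (pderiv i).toLinearMap ∘ₗ (pderiv i).toLinearMap

lemma lapL_apply (φ : Poly D) : lapL D φ = lap φ := by
  simp [lapL, lap]

lemma pderiv_comm (i j : Fin D) (φ : Poly D) :
    pderiv i (pderiv j φ) = pderiv j (pderiv i φ) := by
  ext m
  simp only [coeff_pderiv]
  rw [add_right_comm]
  by_cases h : i = j
  · subst h; rfl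
  · simp [h, Ne.symm h]
    ring

lemma pderiv_r2 (i : Fin D) : pderiv i (r2 D) = 2 * X i := by
  simp only [r2, map_sum, pderiv_mul, pderiv_X]
  simp only [Pi.single_apply, Finset.sum_add_distrib, ite_mul, mul_ite, one_mul, mul_one,
    zero_mul, mul_zero, Finset.sum_ite_eq', Finset.mem_univ, if_true]
  simp [two_mul]

lemma eta_of_hom {n : ℕ} {φ : Poly D} (h : φ.IsHomogeneous n) : eta φ = (n : Poly D) * φ := by
  rw [eta, h.sum_X_mul_pderiv, nsmul_eq_mul]

lemma lap_pderiv (h : Fin D) (φ : Poly D) : lap (pderiv h φ) = pderiv h (lap φ) := by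
  simp only [lap, map_sum]
  refine Finset.sum_congr rfl fun i _ => ?_
  rw [pderiv_comm i h φ, pderiv_comm i h]

lemma lap_mul (F G : Poly D) :
    lap (F * G) = lap F * G + 2 * ∑ i, pderiv i F * pderiv i G + F * lap G := by
  simp only [lap, Finset.sum_mul, Finset.mul_sum, ← Finset.sum_add_distrib]
  refine Finset.sum_congr rfl fun i _ => ?_
  simp only [pderiv_mul, map_add]
  ring

lemma lap_X (h : Fin D) : lap (X h : Poly D) = 0 := by
  simp only [lap, pderiv_X]
  refine Finset.sum_eq_zero fun i _ => ?_
  by_cases hi : i = h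
  · subst hi; simp
  · simp [Ne.symm hi]

lemma lap_X_mul (h : Fin D) (F : Poly D) :
    lap (X h * F) = 2 * pderiv h F + X h * lap F := by
  rw [lap_mul, lap_X]
  simp [pderiv_X, Pi.single_apply]

lemma lap_r2 : lap (r2 D) = 2 * (D : Poly D) := by
  have h2 (i : Fin D) : pderiv i (2 : Poly D) = 0 := by
    rw [← map_ofNat (C : ℂ →+* Poly D) 2, pderiv_C]
  simp [lap, pderiv_r2, h2, mul_comm]

lemma lap_r2_mul (F : Poly D) :
    lap (r2 D * F) = 2 * (D : Poly D) * F + 4 * eta F + r2 D * lap F := by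
  rw [lap_mul, lap_r2]
  simp only [pderiv_r2, eta, Finset.mul_sum]
  congr 2
  refine Finset.sum_congr rfl fun i _ => ?_
  ring

lemma hom_r2 : (r2 D).IsHomogeneous 2 := by
  refine IsHomogeneous.sum _ _ _ fun i _ => ?_
  exact (isHomogeneous_X ℂ i).mul (isHomogeneous_X ℂ i)

lemma r2_ne_zero (hD : 2 ≤ D) : r2 D ≠ 0 := by
  intro h
  have := congrArg (eval (Pi.single (⟨0, by omega⟩ : Fin D) (1 : ℂ))) h
  simp [r2, Pi.single_apply] at this

lemma lap_hom {n : ℕ} {φ : Poly D} (h : φ.IsHomogeneous n) : (lap φ).IsHomogeneous (n - 2) := by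
  refine IsHomogeneous.sum _ _ _ fun i _ => ?_
  have := (h.pderiv (i := i)).pderiv (i := i)
  rwa [Nat.sub_sub] at this

lemma lap_hom_small {n : ℕ} {φ : Poly D} (h : φ.IsHomogeneous n) (hn : n < 2) : lap φ = 0 := by
  refine Finset.sum_eq_zero fun i _ => ?_
  have h1 := h.pderiv (i := i)
  have h0 : n - 1 = 0 := by omega
  rw [h0, ← totalDegree_zero_iff_isHomogeneous, totalDegree_eq_zero_iff_eq_C] at h1
  rw [h1, pderiv_C]

lemma lap_r2_pow_mul {n : ℕ} {g : Poly D} (hg : g.IsHomogeneous n) (m : ℕ) :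
    lap (r2 D ^ (m + 1) * g) =
      r2 D ^ m * ((2 * (m + 1) * (D + 2 * m + 2 * n) : ℕ) * g) + r2 D ^ (m + 1) * lap g := by
  induction m with
  | zero =>
    rw [zero_add, pow_one, lap_r2_mul, eta_of_hom hg]
    push_cast
    ring
  | succ m ih =>
    rw [pow_succ' _ (m + 1), mul_assoc, lap_r2_mul, ih,
      eta_of_hom ((hom_r2.pow (m + 1)).mul hg)]
    push_cast
    ring

lemma harm_r2_pow (hD : 2 ≤ D) (n : ℕ) : ∀ (m : ℕ) (g : Poly D), g.IsHomogeneous n →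
    lap (r2 D ^ (m + 1) * g) = 0 → g = 0 := by
  induction n using Nat.strong_induction_on with
  | _ n ih =>
  intro m g hg h
  have h' := h
  rw [lap_r2_pow_mul hg, pow_succ, mul_assoc (r2 D ^ m) (r2 D), ← mul_add] at h
  have h1 := (mul_eq_zero.1 h).resolve_left (pow_ne_zero _ (r2_ne_zero hD))
  set c : ℕ := 2 * (m + 1) * (D + 2 * m + 2 * n) with hc
  have hc0 : (c : ℂ) ≠ 0 := by
    have : 0 < c := by rw [hc]; positivity
    exact_mod_cast this.ne'
  have hcC : (c : Poly D) = C (c : ℂ) := by simp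
  have h2 : g = r2 D * (C (-(c : ℂ)⁻¹) * lap g) := by
    have : C (c : ℂ)⁻¹ * ((c : Poly D) * g + r2 D * lap g) = 0 := by rw [h1, mul_zero]
    rw [hcC, mul_add, ← mul_assoc, ← C_mul, inv_mul_cancel₀ hc0, C_1, one_mul] at this
    refine (eq_neg_of_add_eq_zero_left this).trans ?_
    rw [C_neg]
    ring
  by_cases hn : n < 2
  · rw [h2, lap_hom_small hg hn]; simp
  · have h3 : (C (-(c : ℂ)⁻¹) * lap g).IsHomogeneous (n - 2) := (lap_hom hg).C_mul _
    have h4 := ih (n - 2) (by omega) (m + 1) _ h3 (by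
      rw [pow_succ, mul_assoc, ← h2]; exact h')
    rw [h2, h4, mul_zero]

lemma exists_hom_factor {n : ℕ} {F : Poly D} (hF : F.IsHomogeneous n) (hd : r2 D ∣ F) :
    ∃ k, ∃ g : Poly D, g.IsHomogeneous k ∧ F = r2 D * g := by
  letI : GradedAlgebra (homogeneousSubmodule (Fin D) ℂ) := MvPolynomial.gradedAlgebra
  obtain ⟨g, rfl⟩ := hd
  have h1 := DirectSum.coe_decompose_mul_of_left_mem (𝒜 := homogeneousSubmodule (Fin D) ℂ)
    (b := g) n (hom_r2 (D := D))
  rw [DirectSum.decompose_of_mem_same _ hF] at h1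
  split_ifs at h1
  · exact ⟨n - 2, _, (DirectSum.decompose (homogeneousSubmodule (Fin D) ℂ) g (n - 2)).2, h1⟩
  · exact ⟨0, 0, isHomogeneous_zero _ _ _, by rw [h1, mul_zero]⟩

/-- Uniqueness of the harmonic part. -/
lemma harm_unique (hD : 2 ≤ D) {n : ℕ} {F G : Poly D} (hF : F.IsHomogeneous n)
    (hG : G.IsHomogeneous n) (lF : lap F = 0) (lG : lap G = 0) (h : r2 D ∣ F - G) : F = G := by
  obtain ⟨k, g, hg, e⟩ := exists_hom_factor (hF.sub hG) h
  have : g = 0 := by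
    refine harm_r2_pow hD k 0 g hg ?_
    rw [zero_add, pow_one, ← e, ← lapL_apply, map_sub, lapL_apply, lapL_apply, lF, lG, sub_zero]
  rw [this, mul_zero] at e
  exact sub_eq_zero.1 e

lemma lsq_of_hom {n : ℕ} {φ : Poly D} (h : φ.IsHomogeneous n) (hl : lap φ = 0) (hD : 2 ≤ D) :
    lsq φ = ((n * (n + D - 2) : ℕ) : Poly D) * φ := by
  have hE : ∑ j, X j * pderiv j φ = (n : Poly D) * φ := eta_of_hom h
  have hE2 (i : Fin D) : ∑ j, X j * pderiv i (pderiv j φ) = ((n : Poly D) - 1) * pderiv i φ := by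
    have := congrArg (pderiv i) hE
    simp only [map_sum, pderiv_mul, pderiv_X, Finset.sum_add_distrib] at this
    have hn : pderiv i (n : Poly D) = 0 := by
      simp
    rw [hn] at this
    simp [Pi.single_apply] at this
    rw [sub_mul, ← this]; ring
  have hang (i j : Fin D) : ang i j (ang i j φ) =
      - ((if i = j then X j * pderiv i φ else 0) + X j * X j * pderiv i (pderiv i φ)
        - X j * pderiv j φ - X j * (X i * pderiv i (pderiv j φ)))
      - ((if i = j then X j * pderiv i φ else 0) + X i * X i * pderiv j (pderiv j φ)
        - X i * pderiv i φ - X i * (X j * pderiv j (pderiv i φ))) := by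
    simp only [ang, Derivation.map_smul, map_sub, pderiv_mul, pderiv_X, mul_smul_comm,
      ← smul_sub, smul_smul, Complex.I_mul_I, neg_smul, one_smul]
    by_cases hij : i = j
    · subst hij; simp; ring
    · simp [hij, Ne.symm hij]
      rw [pderiv_comm j i]
      ring
  have s1 : ∑ i : Fin D, ∑ j : Fin D, (if i = j then X j * pderiv i φ else 0)
      = (n : Poly D) * φ := by
    rw [← hE]; simp
  have s2 : ∑ i : Fin D, ∑ j : Fin D, X j * X j * pderiv i (pderiv i φ) = 0 := by
    simp only [← Finset.sum_mul, ← Finset.mul_sum]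
    change _ * lap φ = 0
    rw [hl, mul_zero]
  have s3 : ∑ i : Fin D, ∑ j : Fin D, X j * pderiv j φ = (D : Poly D) * ((n : Poly D) * φ) := by
    simp [hE]
  have s4 : ∑ i : Fin D, ∑ j : Fin D, X i * (X j * pderiv i (pderiv j φ))
      = ((n : Poly D) - 1) * ((n : Poly D) * φ) := by
    simp only [← Finset.mul_sum, hE2]
    rw [← hE, Finset.mul_sum]
    refine Finset.sum_congr rfl fun i _ => ?_
    ring
  have s4' : ∑ i : Fin D, ∑ j : Fin D, X j * (X i * pderiv i (pderiv j φ))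
      = ((n : Poly D) - 1) * ((n : Poly D) * φ) := by
    rw [← s4]
    refine Finset.sum_congr rfl fun i _ => Finset.sum_congr rfl fun j _ => ?_
    ring
  have hsum : ∑ i : Fin D, ∑ j : Fin D, ang i j (ang i j φ) =
      2 * (((D : Poly D) * ((n : Poly D) * φ)) - (n : Poly D) * φ
        + ((n : Poly D) - 1) * ((n : Poly D) * φ)) := by
    simp only [hang, Finset.sum_add_distrib, Finset.sum_sub_distrib, Finset.sum_neg_distrib]
    rw [s1, s2, s3, s4']
    rw [Finset.sum_comm (f := fun i j : Fin D => X i * X i * pderiv j (pderiv j φ)), s2,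
      Finset.sum_comm (f := fun i j : Fin D => X i * pderiv i φ), s3,
      Finset.sum_comm (f := fun i j : Fin D => X i * (X j * pderiv j (pderiv i φ))), s4']
    ring
  rw [lsq, hsum]
  have h22 : (2 : Poly D) = C (2 : ℂ) := (map_ofNat C 2).symm
  rw [h22, ← smul_eq_C_mul, smul_smul, inv_mul_cancel₀ two_ne_zero, one_smul, Nat.cast_mul,
    Nat.cast_sub (by omega)]
  push_cast
  ring

/-- Append an index at the end. -/
def sn {l : ℕ} (k : Fin l → Fin D) (a : Fin D) : Fin (l + 1) → Fin D :=
  Fin.snoc (α := fun _ => Fin D) k a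

@[simp] lemma sn_castSucc {l : ℕ} (k : Fin l → Fin D) (a : Fin D) (m : Fin l) :
    sn k a m.castSucc = k m := by simp [sn]

@[simp] lemma sn_last {l : ℕ} (k : Fin l → Fin D) (a : Fin D) :
    sn k a (Fin.last l) = a := by simp [sn]

lemma sn_eta {l : ℕ} (j : Fin (l + 1) → Fin D) :
    j = sn (fun m => j m.castSucc) (j (Fin.last l)) :=
  (Fin.snoc_init_self (α := fun _ => Fin D) j).symm

lemma sum_sn {M : Type*} [AddCommMonoid M] {l : ℕ} (f : (Fin (l + 1) → Fin D) → M) :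
    ∑ j, f j = ∑ k : Fin l → Fin D, ∑ a : Fin D, f (sn k a) := by
  rw [Finset.sum_comm, ← Fintype.sum_prod_type' (f := fun a k => f (sn k a))]
  exact (Fintype.sum_equiv (Fin.snocEquiv (fun _ => Fin D)) _ _ (fun _ => rfl)).symm

/-- The harmonic projection of `x^h F`, for `F` harmonic of degree `l`. -/
def stepA (l : ℕ) (h : Fin D) (F : Poly D) : Poly D :=
  X h * F - C (((D : ℂ) + 2 * (l : ℂ) - 2)⁻¹) * (r2 D * pderiv h F)

/-- The harmonic part of `x^{i_1} ⋯ x^{i_l}`. -/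
def hatX (D : ℕ) : (l : ℕ) → (Fin l → Fin D) → Poly D
  | 0, _ => 1
  | l + 1, i => stepA l (i (Fin.last l)) (hatX D l (fun m => i m.castSucc))

lemma hatX_sn {l : ℕ} (k : Fin l → Fin D) (a : Fin D) :
    hatX D (l + 1) (sn k a) = stepA l a (hatX D l k) := by
  simp [hatX]

lemma den_ne (hD : 2 ≤ D) (l : ℕ) : (D : ℂ) + 2 * ((l : ℂ) + 1) - 2 ≠ 0 := by
  have : ((D + 2 * l : ℕ) : ℂ) ≠ 0 := by
    have : 0 < D + 2 * l := by omega
    exact_mod_cast this.ne'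
  intro h
  apply this
  push_cast
  linear_combination h

lemma pderiv_hom_zero {F : Poly D} (h : F.IsHomogeneous 0) (i : Fin D) : pderiv i F = 0 := by
  rw [← totalDegree_zero_iff_isHomogeneous, totalDegree_eq_zero_iff_eq_C] at h
  rw [h, pderiv_C]

lemma stepA_hom {l : ℕ} {F : Poly D} (h : Fin D) (hF : F.IsHomogeneous l) :
    (stepA l h F).IsHomogeneous (l + 1) := by
  refine IsHomogeneous.sub ?_ (IsHomogeneous.C_mul ?_ _)
  · rw [add_comm]; exact (isHomogeneous_X ℂ h).mul hF
  · cases l with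
    | zero => rw [pderiv_hom_zero hF, mul_zero]; exact isHomogeneous_zero _ _ _
    | succ l =>
      have := (hom_r2 (D := D)).mul (hF.pderiv (i := h))
      rwa [show 2 + (l + 1 - 1) = l + 1 + 1 by omega] at this

lemma lap_C_mul (c : ℂ) (F : Poly D) : lap (C c * F) = C c * lap F := by
  rw [← lapL_apply, ← smul_eq_C_mul, map_smul, lapL_apply, smul_eq_C_mul]

lemma lap_smul (c : ℂ) (F : Poly D) : lap (c • F) = c • lap F := by
  rw [← lapL_apply, map_smul, lapL_apply]

lemma lap_sub (F G : Poly D) : lap (F - G) = lap F - lap G := by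
  simp only [← lapL_apply, map_sub]

lemma lap_add (F G : Poly D) : lap (F + G) = lap F + lap G := by
  simp only [← lapL_apply, map_add]

lemma lap_sum {ι : Type*} (s : Finset ι) (f : ι → Poly D) :
    lap (∑ i ∈ s, f i) = ∑ i ∈ s, lap (f i) := by
  simp only [← lapL_apply, map_sum]

lemma stepA_lap (hD : 2 ≤ D) {l : ℕ} {F : Poly D} (h : Fin D) (hF : F.IsHomogeneous l)
    (hl : lap F = 0) : lap (stepA l h F) = 0 := by
  rw [stepA, lap_sub, lap_C_mul, lap_X_mul, lap_r2_mul, lap_pderiv, hl]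
  cases l with
  | zero => simp [pderiv_hom_zero hF, eta]
  | succ l =>
    rw [eta_of_hom (hF.pderiv (i := h))]
    have h1 : 2 * (D : Poly D) * pderiv h F + 4 * (((l + 1 - 1 : ℕ) : Poly D) * pderiv h F)
        = C ((D : ℂ) + 2 * ((l : ℂ) + 1) - 2) * (2 * pderiv h F) := by
      simp only [Nat.add_sub_cancel, map_sub, map_add, map_mul, map_natCast, map_ofNat, map_one]
      ring
    rw [h1, map_zero, mul_zero, mul_zero, add_zero, add_zero, Nat.cast_succ, ← mul_assoc, ← C_mul,
      inv_mul_cancel₀ (den_ne hD l), C_1, one_mul, sub_self]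

lemma hatX_hom (l : ℕ) (i : Fin l → Fin D) : (hatX D l i).IsHomogeneous l := by
  induction l with
  | zero => exact isHomogeneous_one _ _
  | succ l ih => exact stepA_hom _ (ih _)

lemma hatX_lap (hD : 2 ≤ D) (l : ℕ) (i : Fin l → Fin D) : lap (hatX D l i) = 0 := by
  induction l with
  | zero => simp [hatX, lap]
  | succ l ih => exact stepA_lap hD _ (hatX_hom _ _) (ih _)

lemma hatX_dvd (l : ℕ) (i : Fin l → Fin D) : r2 D ∣ hatX D l i - ∏ m, X (i m) := by
  induction l with
  | zero => simp [hatX]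
  | succ l ih =>
    rw [Fin.prod_univ_castSucc, hatX, stepA]
    obtain ⟨g, hg⟩ := ih (fun m => i m.castSucc)
    refine ⟨X (i (Fin.last l)) * g - C (((D : ℂ) + 2 * (l : ℂ) - 2)⁻¹) *
      pderiv (i (Fin.last l)) (hatX D l (fun m => i m.castSucc)), ?_⟩
    linear_combination X (i (Fin.last l)) * hg

lemma hom_smul {n : ℕ} {F : Poly D} (hF : F.IsHomogeneous n) (c : ℂ) :
    (c • F).IsHomogeneous n := by
  rw [smul_eq_C_mul]; exact hF.C_mul c

lemma hatX_unique (hD : 2 ≤ D) {l : ℕ} {i : Fin l → Fin D} {F : Poly D} (hF : F.IsHomogeneous l)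
    (hl : lap F = 0) (h : r2 D ∣ F - ∏ m, X (i m)) : F = hatX D l i := by
  refine harm_unique hD hF (hatX_hom l i) hl (hatX_lap hD l i) ?_
  have := dvd_sub h (hatX_dvd l i)
  rwa [sub_sub_sub_cancel_right] at this

lemma hatX_cons (hD : 2 ≤ D) {l : ℕ} (i : Fin l → Fin D) (h : Fin D) :
    hatX D (l + 1) (Fin.cons h i) = hatX D (l + 1) (sn i h) := by
  refine hatX_unique hD (hatX_hom _ _) (hatX_lap hD _ _) ?_
  have := hatX_dvd (l + 1) (Fin.cons h i : Fin (l + 1) → Fin D)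
  rw [Fin.prod_univ_succ] at this
  rw [Fin.prod_univ_castSucc]
  simp only [Fin.cons_zero, Fin.cons_succ] at this
  simp only [sn_castSucc, sn_last]
  rwa [mul_comm] at this

lemma hatX_trace (hD : 2 ≤ D) {l : ℕ} (i : Fin l → Fin D) (a b : Fin l) (hab : a ≠ b) :
    ∑ h : Fin D, hatX D l (Function.update (Function.update i a h) b h) = 0 := by
  refine harm_unique hD (IsHomogeneous.sum _ _ _ fun h _ => hatX_hom _ _)
    (isHomogeneous_zero _ _ _) ?_ (by simp [lap]) ?_
  · rw [lap_sum]; exact Finset.sum_eq_zero fun h _ => hatX_lap hD _ _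
  · have h1 : r2 D ∣ ∑ h : Fin D, (hatX D l (Function.update (Function.update i a h) b h) -
        ∏ m, X (Function.update (Function.update i a h) b h m)) :=
      Finset.dvd_sum fun h _ => hatX_dvd _ _
    rw [Finset.sum_sub_distrib] at h1
    have h2 : r2 D ∣ ∑ h : Fin D, ∏ m, (X (Function.update (Function.update i a h) b h m) :
        Poly D) := by
      refine ⟨∏ m ∈ (Finset.univ.erase b).erase a, X (i m), ?_⟩
      rw [r2, Finset.sum_mul]
      refine Finset.sum_congr rfl fun h _ => ?_
      rw [← Finset.mul_prod_erase _ _ (Finset.mem_univ b),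
        ← Finset.mul_prod_erase (Finset.univ.erase b) _ (a := a) (by simp [hab]), ← mul_assoc]
      congr 1
      · simp [hab]
      · refine Finset.prod_congr rfl fun m hm => ?_
        simp only [Finset.mem_erase] at hm
        simp [hm.1, hm.2.1]
    have := dvd_add h1 h2
    rwa [sub_add_cancel, ← sub_zero (∑ h : Fin D, hatX D l _)] at this

/-- Iterated derivatives evaluated at the origin. -/
def dLin (D : ℕ) : (l : ℕ) → (Fin l → Fin D) → (Poly D →ₗ[ℂ] ℂ)
  | 0, _ => lcoeff ℂ 0
  | l + 1, j => dLin D l (fun m => j m.castSucc) ∘ₗ (pderiv (j (Fin.last l))).toLinearMap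

lemma dLin_sn {l : ℕ} (k : Fin l → Fin D) (a : Fin D) (F : Poly D) :
    dLin D (l + 1) (sn k a) F = dLin D l k (pderiv a F) := by
  simp [dLin]

lemma dLin_cons {l : ℕ} (k : Fin l → Fin D) (a : Fin D) (F : Poly D) :
    dLin D (l + 1) (Fin.cons a k) F = dLin D (l + 1) (sn k a) F := by
  induction l generalizing F with
  | zero =>
    congr 1
  | succ l ih =>
    have h1 : (Fin.cons a k : Fin (l + 2) → Fin D) =
        sn (Fin.cons a (fun m => k m.castSucc)) (k (Fin.last l)) := by
      rw [sn_eta (Fin.cons a k : Fin (l + 2) → Fin D)]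
      congr 1
      funext m
      refine Fin.cases ?_ (fun m => ?_) m
      · simp
      · rw [Fin.castSucc_succ, Fin.cons_succ, Fin.cons_succ]
    rw [h1, dLin_sn, ih, dLin_sn, dLin_sn, sn_eta k, dLin_sn, pderiv_comm]
    simp

lemma dLin_euler (l : ℕ) (F : Poly D) (hF : F.IsHomogeneous l) :
    ∑ j, dLin D l j F • ∏ m, (X (j m) : Poly D) = (l.factorial : ℂ) • F := by
  induction l generalizing F with
  | zero =>
    rw [← totalDegree_zero_iff_isHomogeneous, totalDegree_eq_zero_iff_eq_C] at hF
    rw [hF]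
    simp [dLin, smul_eq_C_mul]
  | succ l ih =>
    rw [sum_sn, Finset.sum_comm]
    have h1 (a : Fin D) : ∑ k : Fin l → Fin D, dLin D (l + 1) (sn k a) F •
        ∏ m, (X (sn k a m) : Poly D) = (l.factorial : ℂ) • (X a * pderiv a F) := by
      have := ih (pderiv a F) (hF.pderiv (i := a))
      rw [← mul_smul_comm, ← this, Finset.mul_sum]
      refine Finset.sum_congr rfl fun k _ => ?_
      rw [dLin_sn, Fin.prod_univ_castSucc]
      simp only [sn_castSucc, sn_last]
      rw [mul_smul_comm, mul_comm]
    simp only [h1]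
    rw [← Finset.smul_sum]
    have := eta_of_hom hF
    rw [eta] at this
    rw [this, Nat.factorial_succ, smul_eq_C_mul, smul_eq_C_mul]
    simp
    ring

/-- The matrix of the harmonic projection. -/
def matQ (D l : ℕ) : Matrix (Fin l → Fin D) (Fin l → Fin D) ℂ := fun i j =>
  (l.factorial : ℂ)⁻¹ * dLin D l j (hatX D l i)

lemma fac_ne (l : ℕ) : (l.factorial : ℂ) ≠ 0 := by exact_mod_cast l.factorial_ne_zero

lemma matQ_prod (l : ℕ) (i : Fin l → Fin D) :
    ∑ j, matQ D l i j • ∏ m, (X (j m) : Poly D) = hatX D l i := by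
  simp only [matQ, mul_smul]
  rw [← Finset.smul_sum, dLin_euler l _ (hatX_hom l i), smul_smul, inv_mul_cancel₀ (fac_ne l),
    one_smul]

lemma harm_expand (hD : 2 ≤ D) {l : ℕ} {F : Poly D} (hF : F.IsHomogeneous l) (hl : lap F = 0) :
    F = (l.factorial : ℂ)⁻¹ • ∑ j, dLin D l j F • hatX D l j := by
  refine harm_unique hD hF ?_ hl ?_ ?_
  · exact hom_smul (IsHomogeneous.sum _ _ _ fun j _ => hom_smul (hatX_hom _ _) _) _
  · simp [lap_smul, lap_sum, hatX_lap hD]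
  · have h1 : F = (l.factorial : ℂ)⁻¹ • ∑ j, dLin D l j F • ∏ m, (X (j m) : Poly D) := by
      rw [dLin_euler l _ hF, smul_smul, inv_mul_cancel₀ (fac_ne l), one_smul]
    nth_rewrite 1 [h1]
    rw [← smul_sub, ← Finset.sum_sub_distrib, smul_eq_C_mul]
    refine Dvd.dvd.mul_left (Finset.dvd_sum fun j _ => ?_) _
    rw [← smul_sub, smul_eq_C_mul]
    refine Dvd.dvd.mul_left ?_ _
    rw [dvd_sub_comm]
    exact hatX_dvd l j

lemma matQ_hat (hD : 2 ≤ D) (l : ℕ) (i : Fin l → Fin D) :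
    ∑ j, matQ D l i j • hatX D l j = hatX D l i := by
  rw [harm_expand hD (hatX_hom l i) (hatX_lap hD l i), Finset.smul_sum]
  simp only [matQ, mul_smul]

lemma pderiv_hat (hD : 2 ≤ D) (m : ℕ) (i : Fin (m + 1) → Fin D) (q : Fin D) :
    pderiv q (hatX D (m + 1) i) =
      ((m : ℂ) + 1) • ∑ k, matQ D (m + 1) i (sn k q) • hatX D m k := by
  rw [harm_expand hD (l := m) ((hatX_hom (m + 1) i).pderiv (i := q))
    (by rw [lap_pderiv, hatX_lap hD, map_zero]), Finset.smul_sum, Finset.smul_sum]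
  refine Finset.sum_congr rfl fun k _ => ?_
  rw [matQ, dLin_sn, smul_smul, smul_smul, Nat.factorial_succ]
  congr 1
  have := fac_ne m
  have h2 : (m : ℂ) + 1 ≠ 0 := by exact_mod_cast m.succ_ne_zero
  push_cast
  field_simp

lemma key (hD : 2 ≤ D) (m : ℕ) (i : Fin (m + 1) → Fin D) (p q : Fin D) :
    pderiv q (hatX D (m + 2) (sn i p)) =
      (if p = q then hatX D (m + 1) i else 0)
      + ((m : ℂ) + 1) • ∑ k, matQ D (m + 1) i (sn k q) • hatX D (m + 1) (sn k p)
      - (2 * ((m : ℂ) + 1) / ((D : ℂ) + 2 * ((m : ℂ) + 1) - 2)) •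
        ∑ k, matQ D (m + 1) i (sn k p) • hatX D (m + 1) (sn k q) := by
  have hs (a b : Fin D) : r2 D ∣ X b * pderiv a (hatX D (m + 1) i) -
      ((m : ℂ) + 1) • ∑ k, matQ D (m + 1) i (sn k a) • hatX D (m + 1) (sn k b) := by
    rw [pderiv_hat hD, mul_smul_comm, ← smul_sub, Finset.mul_sum, ← Finset.sum_sub_distrib,
      smul_eq_C_mul]
    refine Dvd.dvd.mul_left (Finset.dvd_sum fun k _ => ?_) _
    rw [mul_smul_comm, ← smul_sub, smul_eq_C_mul]
    refine Dvd.dvd.mul_left ?_ _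
    rw [hatX_sn, stepA, sub_sub_cancel]
    exact Dvd.dvd.mul_left (Dvd.intro _ rfl) _
  refine harm_unique hD (n := m + 1) (hatX_hom (m + 2) _).pderiv ?_ ?_ ?_ ?_
  · refine IsHomogeneous.sub (IsHomogeneous.add ?_ (hom_smul ?_ _)) (hom_smul ?_ _)
    · split_ifs
      · exact hatX_hom _ _
      · exact isHomogeneous_zero _ _ _
    · exact IsHomogeneous.sum _ _ _ fun j _ => hom_smul (hatX_hom _ _) _
    · exact IsHomogeneous.sum _ _ _ fun j _ => hom_smul (hatX_hom _ _) _
  · rw [lap_pderiv, hatX_lap hD, map_zero]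
  · split_ifs <;> simp [lap_smul, lap_sum, hatX_lap hD, lap_add, lap_sub]
  · obtain ⟨g1, e1⟩ := hs q p
    obtain ⟨g2, e2⟩ := hs p q
    rw [sub_eq_iff_eq_add] at e1 e2
    set c := ((D : ℂ) + 2 * ((m : ℂ) + 1) - 2)⁻¹ with hc
    have e3 : (2 * ((m : ℂ) + 1) / ((D : ℂ) + 2 * ((m : ℂ) + 1) - 2)) •
        ∑ k, matQ D (m + 1) i (sn k p) • hatX D (m + 1) (sn k q) =
        C c * 2 * (((m : ℂ) + 1) • ∑ k, matQ D (m + 1) i (sn k p) • hatX D (m + 1) (sn k q)) := by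
      rw [← map_ofNat (C : ℂ →+* Poly D) 2, ← C_mul, ← smul_eq_C_mul, smul_smul, div_eq_mul_inv,
        ← hc]
      congr 1
      ring
    rw [e3]
    refine ⟨g1 - C c * 2 * g2 - C c * pderiv q (pderiv p (hatX D (m + 1) i)), ?_⟩
    rw [hatX_sn, stepA, Nat.cast_succ, ← hc, map_sub, pderiv_C_mul, pderiv_mul, pderiv_mul,
      pderiv_r2, pderiv_X, mul_assoc 2, e1, e2]
    generalize ((m : ℂ) + 1) • ∑ k, matQ D (m + 1) i (sn k q) • hatX D (m + 1) (sn k p) = S1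
    generalize ((m : ℂ) + 1) • ∑ k, matQ D (m + 1) i (sn k p) • hatX D (m + 1) (sn k q) = S2
    by_cases hpq : p = q
    · subst hpq; simp; ring
    · simp [hpq]; ring

lemma embAt_sn (m : ℕ) (A : PairMat D) (k k' : Fin m → Fin D) (a p b q : Fin D) :
    embAt D (m + 2) m A (sn (sn k a) p) (sn (sn k' b) q) =
      A (a, p) (b, q) * if k = k' then 1 else 0 := by
  rw [embAt, dif_pos (by omega)]
  have e1 : (⟨m, by omega⟩ : Fin (m + 2)) = (Fin.last m).castSucc := rfl
  have e2 : (⟨m + 1, by omega⟩ : Fin (m + 2)) = Fin.last (m + 1) := rfl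
  rw [e1, e2, Fin.prod_univ_castSucc, Fin.prod_univ_castSucc]
  simp only [sn_castSucc, sn_last]
  congr 1
  simp only [Fin.val_castSucc, Fin.val_last, true_or, or_true, if_true, mul_one]
  have (x : Fin m) : (if (x : ℕ) = m ∨ (x : ℕ) = m + 1 then (1 : ℂ) else
      if k x = k' x then 1 else 0) = if k x = k' x then 1 else 0 := by
    rw [if_neg]; have := x.2; omega
  simp only [this]
  rw [Finset.prod_ite_zero]
  simp [funext_iff]

lemma extendLast_sn (l : ℕ) (A : Matrix (Fin l → Fin D) (Fin l → Fin D) ℂ)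
    (k k' : Fin l → Fin D) (a b : Fin D) :
    extendLast D l A (sn k a) (sn k' b) = A k k' * if a = b then 1 else 0 := by
  simp [extendLast]

lemma triple (m : ℕ) (A : Matrix (Fin (m + 1) → Fin D) (Fin (m + 1) → Fin D) ℂ) (M : PairMat D)
    (i j : Fin (m + 1) → Fin D) (p q : Fin D) :
    (extendLast D (m + 1) A * embAt D (m + 2) m M * extendLast D (m + 1) A) (sn i p) (sn j q) =
      ∑ k : Fin m → Fin D, ∑ a, ∑ b, A i (sn k a) * M (a, p) (b, q) * A (sn k b) j := by
  simp only [Matrix.mul_apply]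
  rw [sum_sn]
  simp only [extendLast_sn, mul_ite, mul_one, mul_zero, Finset.sum_ite_eq', Finset.mem_univ,
    if_true]
  rw [sum_sn]
  refine Finset.sum_congr rfl fun k' _ => ?_
  have h1 (b : Fin D) : ∑ u, extendLast D (m + 1) A (sn i p) u *
      embAt D (m + 2) m M u (sn (sn k' b) q) = ∑ a, A i (sn k' a) * M (a, p) (b, q) := by
    rw [sum_sn]
    simp only [extendLast_sn, mul_ite, mul_one, mul_zero, ite_mul, zero_mul, Finset.sum_ite_eq,
      Finset.mem_univ, if_true]
    rw [sum_sn, Finset.sum_comm]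
    refine Finset.sum_congr rfl fun a _ => ?_
    simp [embAt_sn]
  simp only [h1, Finset.sum_mul]
  rw [Finset.sum_comm]

lemma matQ_idem (hD : 2 ≤ D) (l : ℕ) (i j : Fin l → Fin D) :
    ∑ k, matQ D l i k * matQ D l k j = matQ D l i j := by
  have h := congrArg (dLin D l j) (matQ_hat hD l i)
  simp only [map_sum, map_smul, smul_eq_mul] at h
  rw [matQ, ← h, Finset.mul_sum]
  refine Finset.sum_congr rfl fun k _ => ?_
  simp only [matQ]
  ring

lemma matQ_succ (hD : 2 ≤ D) (m : ℕ) (i j : Fin (m + 1) → Fin D) (p q : Fin D) :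
    matQ D (m + 2) (sn i p) (sn j q) = ((m : ℂ) + 1 + 1)⁻¹ *
      ((if p = q then matQ D (m + 1) i j else 0)
      + ((m : ℂ) + 1) * ∑ k, matQ D (m + 1) i (sn k q) * matQ D (m + 1) (sn k p) j
      - (2 * ((m : ℂ) + 1) / ((D : ℂ) + 2 * ((m : ℂ) + 1) - 2)) *
        ∑ k, matQ D (m + 1) i (sn k p) * matQ D (m + 1) (sn k q) j) := by
  have hq (k : Fin (m + 1) → Fin D) : dLin D (m + 1) j (hatX D (m + 1) k) =
      ((m + 1).factorial : ℂ) * matQ D (m + 1) k j := by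
    rw [matQ, mul_inv_cancel_left₀ (fac_ne _)]
  have hs (a b : Fin D) : ∑ k : Fin m → Fin D, matQ D (m + 1) i (sn k a) *
      (((m + 1).factorial : ℂ) * matQ D (m + 1) (sn k b) j) =
      ((m + 1).factorial : ℂ) * ∑ k, matQ D (m + 1) i (sn k a) * matQ D (m + 1) (sn k b) j := by
    rw [Finset.mul_sum]
    refine Finset.sum_congr rfl fun k _ => ?_
    ring
  have hite : dLin D (m + 1) j (if p = q then hatX D (m + 1) i else 0) =
      ((m + 1).factorial : ℂ) * (if p = q then matQ D (m + 1) i j else 0) := by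
    split_ifs
    · exact hq i
    · simp
  rw [matQ, dLin_sn, key hD]
  simp only [map_sum, map_smul, smul_eq_mul, map_add, map_sub, hq, hs, hite]
  rw [Nat.factorial_succ (m + 1)]
  have h1 := fac_ne (m + 1)
  have h2 : (m : ℂ) + 1 + 1 ≠ 0 := by exact_mod_cast (m + 1).succ_ne_zero
  push_cast
  field_simp

lemma symProj_eq (hD : 2 ≤ D) (l : ℕ) : symProj D l = matQ D l := by
  induction l with
  | zero =>
    ext i j
    rw [Subsingleton.elim i j]
    simp [symProj, matQ, hatX, dLin]
  | succ l ih =>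
    cases l with
    | zero =>
      ext i j
      rw [sn_eta i, sn_eta j]
      generalize i (Fin.last 0) = p
      generalize j (Fin.last 0) = q
      generalize (fun m : Fin 0 => i m.castSucc) = i0
      generalize (fun m : Fin 0 => j m.castSucc) = j0
      rw [Subsingleton.elim i0 j0, matQ, dLin_sn, hatX_sn]
      have : (sn j0 p = sn j0 q) ↔ p = q :=
        ⟨fun h => by rw [← sn_last j0 p, h, sn_last], fun h => by rw [h]⟩
      by_cases hpq : p = q
      · subst hpq; simp [symProj, stepA, hatX, dLin]
      · simp [symProj, stepA, hatX, dLin, Matrix.one_apply, this, hpq]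
    | succ m =>
      ext i j
      rw [sn_eta i, sn_eta j]
      generalize i (Fin.last (m + 1)) = p
      generalize j (Fin.last (m + 1)) = q
      generalize (fun x : Fin (m + 1) => i x.castSucc) = i0
      generalize (fun x : Fin (m + 1) => j x.castSucc) = j0
      rw [symProj, ih, triple, matQ_succ hD]
      have hD0 : (D : ℂ) ≠ 0 := by
        have : D ≠ 0 := by omega
        exact_mod_cast this
      have hM (a b : Fin D) : MStep D (m + 1) (a, p) (b, q) = ((m : ℂ) + 1 + 1)⁻¹ *
          ((if a = b then (if p = q then 1 else 0) else 0)
            + ((m : ℂ) + 1) * (if a = q then (if b = p then 1 else 0) else 0)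
            - (2 * ((m : ℂ) + 1) / ((D : ℂ) + 2 * ((m : ℂ) + 1) - 2)) *
              (if a = p then (if b = q then 1 else 0) else 0)) := by
        simp only [MStep, flipMat, traceMat, Matrix.smul_apply, Matrix.add_apply,
          Matrix.sub_apply, Matrix.one_apply, smul_eq_mul, Nat.cast_succ, Prod.mk.injEq, ite_and,
          eq_comm (a := p) (b := b)]
        congr 1
        congr 1
        have := den_ne hD m
        split_ifs <;> simp <;> field_simp
      simp only [hM]
      rw [← matQ_idem hD (m + 1) i0 j0, sum_sn]
      have hsp (k : Fin m → Fin D) :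
          ∑ a, ∑ b, matQ D (m + 1) i0 (sn k a) * (((m : ℂ) + 1 + 1)⁻¹ *
          ((if a = b then (if p = q then 1 else 0) else 0)
            + ((m : ℂ) + 1) * (if a = q then (if b = p then 1 else 0) else 0)
            - (2 * ((m : ℂ) + 1) / ((D : ℂ) + 2 * ((m : ℂ) + 1) - 2)) *
              (if a = p then (if b = q then 1 else 0) else 0))) * matQ D (m + 1) (sn k b) j0 =
          ((m : ℂ) + 1 + 1)⁻¹ *
      ((if p = q then ∑ a, matQ D (m + 1) i0 (sn k a) * matQ D (m + 1) (sn k a) j0 else 0)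
      + ((m : ℂ) + 1) * (matQ D (m + 1) i0 (sn k q) * matQ D (m + 1) (sn k p) j0)
      - (2 * ((m : ℂ) + 1) / ((D : ℂ) + 2 * ((m : ℂ) + 1) - 2)) *
        (matQ D (m + 1) i0 (sn k p) * matQ D (m + 1) (sn k q) j0)) := by
        simp only [mul_add, mul_sub, add_mul, sub_mul, Finset.sum_add_distrib,
          Finset.sum_sub_distrib]
        congr 1
        · congr 1
          · split_ifs
            · simp only [mul_ite, ite_mul, mul_zero, zero_mul, Finset.sum_ite_eq,
                Finset.mem_univ, if_true, Finset.mul_sum]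
              refine Finset.sum_congr rfl fun a _ => ?_
              ring
            · simp
          · simp [Finset.sum_ite_irrel]
            ring
        · simp [Finset.sum_ite_irrel]
          ring
      simp only [hsp]
      rw [← Finset.mul_sum, Finset.sum_sub_distrib, Finset.sum_add_distrib, ← Finset.mul_sum,
        ← Finset.mul_sum]
      congr 3
      split_ifs <;> simp

lemma harmX_eq (hD : 2 ≤ D) (l : ℕ) (i : Fin l → Fin D) : harmX D l i = hatX D l i := by
  rw [harmX, symProj_eq hD, matQ_prod]

lemma eval_r2 (p : Sph D) : eval (crd p) (r2 D) = 1 := by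
  have h : ‖(p : EuclideanSpace ℝ (Fin D))‖ = 1 := by simpa using p.2
  have h2 : ∑ i, (p : EuclideanSpace ℝ (Fin D)) i ^ 2 = 1 := by
    have := EuclideanSpace.real_norm_sq_eq (p : EuclideanSpace ℝ (Fin D))
    rw [← this, h, one_pow]
  simp only [r2, map_sum, map_mul, eval_X, crd]
  simp only [← pow_two]
  exact_mod_cast h2

lemma harmT_eq (hD : 2 ≤ D) (l : ℕ) (i : Fin l → Fin D) (p : Sph D) :
    harmT D l i p = eval (crd p) (hatX D l i) := by
  rw [harmT, rest, harmX_eq hD]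

/-- The recursion for the harmonic polynomials, restricted to the sphere. -/
lemma harmT_cons (hD : 2 ≤ D) (l : ℕ) (i : Fin l → Fin D) (h : Fin D) (p : Sph D) :
    harmT D (l + 1) (Fin.cons h i) p = crd p h * harmT D l i p -
      ((D : ℂ) + 2 * (l : ℂ) - 2)⁻¹ * eval (crd p) (pderiv h (hatX D l i)) := by
  rw [harmT_eq hD, harmT_eq hD, hatX_cons hD, hatX_sn, stepA]
  simp [eval_r2]

end Aux

/-- As functions on the unit sphere:
(i) `t^h T_l = T_{l+1}^{h i…} + (l/(D+2l−2)) 𝒫^l{}^{i…}_{h j…} T_{l−1}^{j…}`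
(the case `l = 0`, where the second term is absent, is stated separately);
(ii) `Σ_i t^i T_l^{i i_2…} = (1/(D+2l−2))[D+l−1−(2l−2)/(D+2l−4)] T_{l−1}`;
(iii) `L² T_l = l(l+D−2) T_l`, where `L² T_l` is the restriction to the sphere of the
spherical Laplacian applied to the harmonic polynomial `X_l`;
(iv) the `T_l` are trace-free in adjacent indices. -/
theorem statement7 (D : ℕ) (hD : 2 ≤ D) :
    (∀ h : Fin D, ∀ i : Fin 0 → Fin D, ∀ p : Sph D,
      tfun h p * harmT D 0 i p = harmT D 1 (Fin.cons h i) p) ∧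
    (∀ m : ℕ, ∀ h : Fin D, ∀ i : Fin (m + 1) → Fin D, ∀ p : Sph D,
      tfun h p * harmT D (m + 1) i p =
        harmT D (m + 2) (Fin.cons h i) p +
          (((m : ℂ) + 1) / ((D : ℂ) + 2 * ((m : ℂ) + 1) - 2)) *
            ∑ j : Fin m → Fin D, symProj D (m + 1) i (Fin.cons h j) * harmT D m j p) ∧
    (∀ m : ℕ, ¬(D = 2 ∧ m = 0) → ∀ i : Fin m → Fin D, ∀ p : Sph D,
      ∑ h : Fin D, tfun h p * harmT D (m + 1) (Fin.cons h i) p =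
        (((D : ℂ) + 2 * ((m : ℂ) + 1) - 2)⁻¹ *
            ((D : ℂ) + ((m : ℂ) + 1) - 1 -
              (2 * ((m : ℂ) + 1) - 2) / ((D : ℂ) + 2 * ((m : ℂ) + 1) - 4))) *
          harmT D m i p) ∧
    (∀ l : ℕ, ∀ i : Fin l → Fin D, ∀ p : Sph D,
      rest (lsq (harmX D l i)) p = ((l * (l + D - 2) : ℕ) : ℂ) * harmT D l i p) ∧
    (∀ l : ℕ, ∀ i : Fin l → Fin D, ∀ n : ℕ, ∀ hn : n + 1 < l, ∀ p : Sph D,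
      ∑ h : Fin D,
        harmT D l
          (Function.update (Function.update i ⟨n, Nat.lt_of_succ_lt hn⟩ h) ⟨n + 1, hn⟩ h) p
        = 0) := by
  refine ⟨?_, ?_, ?_, ?_, ?_⟩
  · intro h i p
    rw [harmT_cons hD]
    simp [tfun, hatX]
  · intro m h i p
    rw [harmT_cons hD, pderiv_hat hD, symProj_eq hD]
    have hQ (j : Fin m → Fin D) : matQ D (m + 1) i (Fin.cons h j) = matQ D (m + 1) i (sn j h) := by
      rw [matQ, matQ, dLin_cons]
    simp only [hQ, harmT_eq hD, MvPolynomial.smul_eval, map_sum, tfun]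
    push_cast
    ring
  · intro m hm i p
    have hE := congrArg (MvPolynomial.eval (crd p)) (eta_of_hom (hatX_hom m i))
    simp only [eta, map_sum, map_mul, MvPolynomial.eval_X, map_natCast] at hE
    have hr := eval_r2 p
    simp only [r2, map_sum, map_mul, MvPolynomial.eval_X] at hr
    have h1 : ∑ h : Fin D, tfun h p * harmT D (m + 1) (Fin.cons h i) p =
        (∑ h : Fin D, crd p h * crd p h) * harmT D m i p - ((D : ℂ) + 2 * (m : ℂ) - 2)⁻¹ *
          ∑ h : Fin D, crd p h * MvPolynomial.eval (crd p) (MvPolynomial.pderiv h (hatX D m i)) := by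
      rw [Finset.sum_mul, Finset.mul_sum, ← Finset.sum_sub_distrib]
      refine Finset.sum_congr rfl fun h _ => ?_
      rw [harmT_cons hD, tfun]
      ring
    rw [h1, hr, hE, ← harmT_eq hD, ← mul_assoc, ← sub_mul]
    congr 1
    have d1 := den_ne hD m
    have d2 : (D : ℂ) + 2 * (m : ℂ) - 2 ≠ 0 := by
      intro h0
      have : ((D + 2 * m : ℕ) : ℂ) = ((2 : ℕ) : ℂ) := by
        push_cast
        linear_combination h0
      have := Nat.cast_injective this
      omega
    rw [show (D : ℂ) + 2 * ((m : ℂ) + 1) - 4 = (D : ℂ) + 2 * (m : ℂ) - 2 by ring]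
    field_simp
    ring
  · intro l i p
    rw [harmT, harmX_eq hD, lsq_of_hom (hatX_hom l i) (hatX_lap hD l i) hD]
    simp only [rest, map_mul, map_natCast]
  · intro l i n hn p
    simp only [harmT_eq hD]
    rw [← map_sum, hatX_trace hD i _ _ (by simp), map_zero]

end Fuzzy
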